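/- Let 1 ≤ r ≤ n, let X ∈ ℝ^{n×r} satisfy XᵀX = I_r, and let S ∈ ℝ^{r×r} be symmetric with ‖S‖ < 1 (Frobenius norm; equivalently ‖XS‖ < 1). Then X is the unique projection of X + XS onto the Stiefel manifold: for every Z ∈ ℝ^{n×r} with ZᵀZ = I_r and Z ≠ X, one has ‖XS‖ = ‖(X + XS) − X‖ < ‖(X + XS) − Z‖. -/

import Mathlib

open Matrix

/-- Frobenius norm of a real matrix: `‖A‖ = √(trace (Aᵀ * A))`. -/
noncomputable def frobNorm {m n : ℕ} (A : Matrix (Fin m) (Fin n) ℝ) : ℝ :=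
  Real.sqrt (Matrix.trace (Aᵀ * A))

open scoped Matrix.Norms.Frobenius in
theorem frobNorm_eq_norm {m n : ℕ} (A : Matrix (Fin m) (Fin n) ℝ) : frobNorm A = ‖A‖ := by
  rw [frobNorm, Matrix.frobenius_norm_def, ← Real.sqrt_eq_rpow, Finset.sum_comm]
  congr 1
  simp [Matrix.trace, Matrix.mul_apply, pow_two]

open scoped Matrix.Norms.Frobenius in
theorem frobNorm_mul_le {l m n : ℕ} (A : Matrix (Fin l) (Fin m) ℝ)
    (B : Matrix (Fin m) (Fin n) ℝ) : frobNorm (A * B) ≤ frobNorm A * frobNorm B := by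
  simpa only [frobNorm_eq_norm] using Matrix.frobenius_norm_mul A B

open scoped Matrix.Norms.Frobenius in
theorem frobNorm_pos {m n : ℕ} {A : Matrix (Fin m) (Fin n) ℝ} (hA : A ≠ 0) : 0 < frobNorm A := by
  simpa only [frobNorm_eq_norm] using norm_pos_iff.mpr hA

theorem frobNorm_nonneg {m n : ℕ} (A : Matrix (Fin m) (Fin n) ℝ) : 0 ≤ frobNorm A :=
  Real.sqrt_nonneg _

theorem frobNorm_sq {m n : ℕ} (A : Matrix (Fin m) (Fin n) ℝ) :
    frobNorm A ^ 2 = (Aᵀ * A).trace := by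
  refine Real.sq_sqrt ?_
  simpa using (Matrix.posSemidef_conjTranspose_mul_self A).trace_nonneg

theorem trace_transpose_mul_comm {m n : ℕ} (A B : Matrix (Fin m) (Fin n) ℝ) :
    (Aᵀ * B).trace = (Bᵀ * A).trace := by
  rw [← Matrix.trace_transpose, Matrix.transpose_mul, Matrix.transpose_transpose]

theorem frobNorm_add_sq {m n : ℕ} (A B : Matrix (Fin m) (Fin n) ℝ) :
    frobNorm (A + B) ^ 2 = frobNorm A ^ 2 + 2 * (Aᵀ * B).trace + frobNorm B ^ 2 := by
  simp only [frobNorm_sq, Matrix.transpose_add, Matrix.add_mul, Matrix.mul_add, Matrix.trace_add,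
    trace_transpose_mul_comm B A]
  ring

theorem frobNorm_sub_sq {m n : ℕ} (A B : Matrix (Fin m) (Fin n) ℝ) :
    frobNorm (A - B) ^ 2 = frobNorm A ^ 2 - 2 * (Aᵀ * B).trace + frobNorm B ^ 2 := by
  simp only [frobNorm_sq, Matrix.transpose_sub, Matrix.sub_mul, Matrix.mul_sub, Matrix.trace_sub,
    trace_transpose_mul_comm B A]
  ring

/-- The inner product of a normal vector `X * S` with a chord `Z - X` of the Stiefel manifold is
quadratic in the chord. -/
theorem two_mul_trace_normal_mul_chord {n r : ℕ} {X Z : Matrix (Fin n) (Fin r) ℝ}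
    (hX : Xᵀ * X = 1) (hZ : Zᵀ * Z = 1) {S : Matrix (Fin r) (Fin r) ℝ} (hS : S.IsSymm) :
    2 * ((X * S)ᵀ * (Z - X)).trace = -((Z - X)ᵀ * ((Z - X) * S)).trace := by
  have h : (S * (Zᵀ * X)).trace = (S * (Xᵀ * Z)).trace := by
    rw [← Matrix.trace_transpose, Matrix.transpose_mul, Matrix.transpose_mul,
      Matrix.transpose_transpose, hS.eq, Matrix.trace_mul_comm]
  rw [← Matrix.mul_assoc, Matrix.trace_mul_comm _ S, Matrix.transpose_mul, hS.eq, Matrix.mul_assoc]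
  simp only [Matrix.transpose_sub, Matrix.sub_mul, Matrix.mul_sub, Matrix.trace_sub, hX, hZ, h]
  ring

/-- Example 4.4: for `X ∈ St(r,n)` and a normal vector `W = XS` (`S` symmetric)
with `‖S‖ < 1`, the point `X` is the unique projection of `X + XS` onto the
Stiefel manifold: every other `Z ∈ St(r,n)` is strictly farther from `X + XS`. -/
theorem stiefel_projection_of_normal_perturbation {n r : ℕ} (hr : 1 ≤ r) (hrn : r ≤ n)
    (X : Matrix (Fin n) (Fin r) ℝ) (hX : Xᵀ * X = 1)
    (S : Matrix (Fin r) (Fin r) ℝ) (hS : S.IsSymm) (hSnorm : frobNorm S < 1) :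
    ∀ Z : Matrix (Fin n) (Fin r) ℝ, Zᵀ * Z = 1 → Z ≠ X →
      frobNorm ((X + X * S) - X) < frobNorm ((X + X * S) - Z) := by
  intro Z hZ hne
  have hpos : 0 < frobNorm (Z - X) := frobNorm_pos (sub_ne_zero.mpr hne)
  have hlt : frobNorm ((Z - X) * S) < frobNorm (Z - X) :=
    (frobNorm_mul_le _ _).trans_lt (mul_lt_of_lt_one_right hpos hSnorm)
  have hsq := pow_lt_pow_left₀ hlt (frobNorm_nonneg _) two_ne_zero
  have hchord := two_mul_trace_normal_mul_chord hX hZ hS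
  have hadd := frobNorm_add_sq (Z - X) ((Z - X) * S)
  have hsub := frobNorm_sub_sq (X * S) (Z - X)
  rw [add_sub_cancel_left, show X + X * S - Z = X * S - (Z - X) by abel]
  refine lt_of_pow_lt_pow_left₀ 2 (frobNorm_nonneg _) ?_
  linarith [sq_nonneg (frobNorm (Z - X + (Z - X) * S))]
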